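/- Let g be measurable on (0,∞) with ∫_0^∞ |g(τ)|·(τ²+1) dτ < ∞ and let 0 < β < 2π. Then the function u(r,θ) = ∫_0^∞ 𝒦(r,τ)·(sinh(θτ)/sinh(βτ))·g(τ) dτ is well-defined on the wedge {(r,θ) : r > 0, 0 ≤ θ ≤ β}, satisfies the fourth-order partial differential equation r³·∂⁴u/∂r⁴ + r·∂⁴u/∂r²∂θ² + (11/2)·r²·∂³u/∂r³ + (1/2)·∂³u/∂r∂θ² + (11/2)·r·∂²u/∂r² + (1/2)·∂u/∂r − u = 0 there, and u(r,θ) → 0 as r → ∞ for each fixed θ ∈ [0,β]. -/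

import Mathlib

open MeasureTheory Set Filter Asymptotics

/-- Modified Bessel function of the second kind (integral representation, for Re z > 0). -/
noncomputable def besselK (nu z : ℂ) : ℂ :=
  ∫ t in Set.Ioi (0:ℝ), Complex.exp (-z * (Real.cosh t : ℂ)) * Complex.cosh (nu * (t : ℂ))

/-- The kernel 𝒦(x,τ) = ker²_{2iτ}(2(4x)^{1/4}) + kei²_{2iτ}(2(4x)^{1/4})
    = K_{2iτ}(2(4x)^{1/4}e^{iπ/4}) · K_{2iτ}(2(4x)^{1/4}e^{-iπ/4}), which is real. -/
noncomputable def kernelK (x τ : ℝ) : ℝ :=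
  (besselK (2 * Complex.I * (τ:ℂ))
      (((2 * (4*x) ^ ((1:ℝ)/4) : ℝ) : ℂ) * Complex.exp (Complex.I * (Real.pi:ℂ) / 4)) *
   besselK (2 * Complex.I * (τ:ℂ))
      (((2 * (4*x) ^ ((1:ℝ)/4) : ℝ) : ℂ) * Complex.exp (-(Complex.I * (Real.pi:ℂ)) / 4))).re

/-- K₀(y) = ∫₀^∞ exp(−y·cosh t) dt. -/
noncomputable def besselK0 (y : ℝ) : ℝ := ∫ t in Set.Ioi (0:ℝ), Real.exp (-y * Real.cosh t)

/-- K_{iτ}(x) = ∫₀^∞ exp(−x·cosh t)·cos(τt) dt (real-valued, purely imaginary order). -/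
noncomputable def besselKi (τ x : ℝ) : ℝ :=
  ∫ t in Set.Ioi (0:ℝ), Real.exp (-x * Real.cosh t) * Real.cos (τ * t)

/-- Modified Bessel function of the first kind I_ν(z) (power series). -/
noncomputable def besselI (nu z : ℂ) : ℂ :=
  ∑' n : ℕ, (z/2) ^ (nu + 2*(n:ℂ)) / ((n.factorial : ℂ) * Complex.Gamma (nu + (n:ℂ) + 1))

/-- B_ν(w) = ber²_ν(w) + bei²_ν(w) = I_ν(w·e^{iπ/4})·I_ν(w·e^{−iπ/4}). -/
noncomputable def kelvinB (nu w : ℂ) : ℂ :=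
  besselI nu (w * Complex.exp (Complex.I * (Real.pi:ℂ) / 4)) *
  besselI nu (w * Complex.exp (-(Complex.I * (Real.pi:ℂ)) / 4))

/-- Index transform (1.1): (F f)(τ) = ∫₀^∞ 𝒦(x,τ) f(x) dx. -/
noncomputable def indexF (f : ℝ → ℝ) (τ : ℝ) : ℝ := ∫ x in Set.Ioi (0:ℝ), kernelK x τ * f x

/-- Index transform (1.2): (G g)(x) = ∫₀^∞ 𝒦(x,τ) g(τ) dτ. -/
noncomputable def indexG (g : ℝ → ℝ) (x : ℝ) : ℝ := ∫ τ in Set.Ioi (0:ℝ), kernelK x τ * g τ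

/-- Index transform (1.2) for complex-valued densities. -/
noncomputable def indexGC (g : ℝ → ℂ) (x : ℝ) : ℂ :=
  ∫ τ in Set.Ioi (0:ℝ), (kernelK x τ : ℂ) * g τ

/-- Mellin transform of a real function. -/
noncomputable def mellinT (f : ℝ → ℝ) (s : ℂ) : ℂ :=
  ∫ x in Set.Ioi (0:ℝ), (f x : ℂ) * (x:ℂ) ^ (s - 1)

/-- Mellin transform of a complex function. -/
noncomputable def mellinC (F : ℝ → ℂ) (s : ℂ) : ℂ :=
  ∫ x in Set.Ioi (0:ℝ), F x * (x:ℂ) ^ (s - 1)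

/-- The L_{ν,p}(ℝ₊) norm. -/
noncomputable def Lnorm (ν p : ℝ) (f : ℝ → ℝ) : ℝ :=
  (∫ x in Set.Ioi (0:ℝ), |f x| ^ p * x ^ (ν*p - 1)) ^ (1/p)

/-- Euler beta function B(a,b) = Γ(a)Γ(b)/Γ(a+b). -/
noncomputable def betaFn (a b : ℝ) : ℝ := Real.Gamma a * Real.Gamma b / Real.Gamma (a+b)

/-- The function u(r,θ) of (4.3); the ratio sinh(θτ)/sinh(βτ) is interpreted as θ/β at τ = 0. -/
noncomputable def wedgeU (g : ℝ → ℝ) (β r θ : ℝ) : ℝ :=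
  ∫ τ in Set.Ioi (0:ℝ), kernelK r τ *
    (if τ = 0 then θ/β else Real.sinh (θ*τ)/Real.sinh (β*τ)) * g τ

/-- The point `e^{iπ/4} cosh (t + iα)` of the shifted integration contour. -/
noncomputable def rotCosh (α t : ℝ) : ℂ :=
  Complex.exp (Complex.I * (Real.pi : ℂ) / 4) * Complex.cosh (t + α * Complex.I)

/-- The companion `e^{iπ/4} sinh (t + iα)` of `rotCosh`. -/
noncomputable def rotSinh (α t : ℝ) : ℂ :=
  Complex.exp (Complex.I * (Real.pi : ℂ) / 4) * Complex.sinh (t + α * Complex.I)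

/-- The integrand of `2 K_{2iτ}(w e^{iπ/4})` along the line `Im t = α`. -/
noncomputable def rotKernel (α w τ t : ℝ) : ℂ :=
  Complex.exp (-(w * rotCosh α t) + 2 * Complex.I * τ * (t + α * Complex.I))

lemma exp_I_pi_div_four :
    Complex.exp (Complex.I * (Real.pi : ℂ) / 4)
      = ((√2 / 2 : ℝ) : ℂ) + ((√2 / 2 : ℝ) : ℂ) * Complex.I := by
  rw [show Complex.I * (Real.pi : ℂ) / 4 = ((Real.pi / 4 : ℝ) : ℂ) * Complex.I by push_cast; ring,
    Complex.exp_mul_I, ← Complex.ofReal_cos, ← Complex.ofReal_sin, Real.cos_pi_div_four,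
    Real.sin_pi_div_four]

lemma exp_I_pi_div_four_sq :
    Complex.exp (Complex.I * (Real.pi : ℂ) / 4) ^ 2 = Complex.I := by
  rw [← Complex.exp_nat_mul, show ((2 : ℕ) : ℂ) * (Complex.I * (Real.pi : ℂ) / 4)
    = Real.pi / 2 * Complex.I by push_cast; ring, Complex.exp_pi_div_two_mul_I]

lemma norm_exp_I_pi_div_four : ‖Complex.exp (Complex.I * (Real.pi : ℂ) / 4)‖ = 1 := by
  rw [show Complex.I * (Real.pi : ℂ) / 4 = ((Real.pi / 4 : ℝ) : ℂ) * Complex.I by push_cast; ring,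
    Complex.norm_exp_ofReal_mul_I]

lemma cosh_shift (α t : ℝ) : Complex.cosh (t + α * Complex.I)
    = ((Real.cosh t * Real.cos α : ℝ) : ℂ) + ((Real.sinh t * Real.sin α : ℝ) : ℂ) * Complex.I := by
  rw [Complex.cosh_add, Complex.cosh_mul_I, Complex.sinh_mul_I]
  push_cast; ring

lemma sinh_shift (α t : ℝ) : Complex.sinh (t + α * Complex.I)
    = ((Real.sinh t * Real.cos α : ℝ) : ℂ) + ((Real.cosh t * Real.sin α : ℝ) : ℂ) * Complex.I := by
  rw [Complex.sinh_add, Complex.cosh_mul_I, Complex.sinh_mul_I]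
  push_cast; ring

lemma norm_rotCosh_le (α t : ℝ) : ‖rotCosh α t‖ ≤ Real.cosh t := by
  rw [rotCosh, norm_mul, norm_exp_I_pi_div_four, one_mul, cosh_shift, Complex.norm_add_mul_I]
  refine Real.sqrt_le_iff.2 ⟨(Real.cosh_pos t).le, ?_⟩
  nlinarith [Real.sin_sq_add_cos_sq α, Real.cosh_sq t, sq_nonneg (Real.sin α)]

lemma norm_rotSinh_le (α t : ℝ) : ‖rotSinh α t‖ ≤ Real.cosh t := by
  rw [rotSinh, norm_mul, norm_exp_I_pi_div_four, one_mul, sinh_shift, Complex.norm_add_mul_I]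
  refine Real.sqrt_le_iff.2 ⟨(Real.cosh_pos t).le, ?_⟩
  nlinarith [Real.sin_sq_add_cos_sq α, Real.cosh_sq t, sq_nonneg (Real.cos α)]

lemma le_re_rotCosh {α : ℝ} (hα : |α| ≤ 1 / 2) (t : ℝ) :
    Real.cosh t / 4 ≤ (rotCosh α t).re := by
  have hre : (rotCosh α t).re
      = √2 / 2 * (Real.cosh t * Real.cos α - Real.sinh t * Real.sin α) := by
    rw [rotCosh, exp_I_pi_div_four, cosh_shift]
    simp only [Complex.mul_re, Complex.add_re, Complex.add_im, Complex.ofReal_re,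
      Complex.ofReal_im, Complex.im_ofReal_mul, Complex.I_re, Complex.I_im]
    ring
  have hsq : (7 / 10 : ℝ) ≤ √2 / 2 := by
    have : (7 / 5 : ℝ) ≤ √2 := Real.le_sqrt_of_sq_le (by norm_num)
    linarith
  have hc := Real.cosh_pos t
  have hcos : 7 / 8 ≤ Real.cos α := by
    have := Real.one_sub_sq_div_two_le_cos (x := α)
    nlinarith [sq_abs α, abs_nonneg α]
  have hsin : |Real.sin α| ≤ 1 / 2 := Real.abs_sin_le_abs.trans hα
  have hsinh : |Real.sinh t| ≤ Real.cosh t := by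
    refine abs_le_of_sq_le_sq ?_ hc.le
    nlinarith [Real.cosh_sq t]
  have hprod : Real.sinh t * Real.sin α ≤ Real.cosh t * (1 / 2) := by
    refine (le_abs_self _).trans ?_
    rw [abs_mul]
    gcongr
  have hmain : 3 / 8 * Real.cosh t ≤ Real.cosh t * Real.cos α - Real.sinh t * Real.sin α := by
    nlinarith
  rw [hre]
  nlinarith

lemma continuous_rotCosh (α : ℝ) : Continuous (rotCosh α) := by
  unfold rotCosh; fun_prop

lemma continuous_rotKernel (α w τ : ℝ) : Continuous (rotKernel α w τ) := by
  unfold rotKernel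
  have := continuous_rotCosh α
  fun_prop

lemma norm_rotKernel_le {α w : ℝ} (hα : |α| ≤ 1 / 2) (hw : 0 ≤ w) (τ t : ℝ) :
    ‖rotKernel α w τ t‖ ≤ Real.exp (-(2 * τ * α)) * Real.exp (-(w / 4) * Real.cosh t) := by
  rw [rotKernel, Complex.norm_exp, ← Real.exp_add]
  refine Real.exp_le_exp.2 ?_
  have := mul_le_mul_of_nonneg_left (le_re_rotCosh hα t) hw
  simp
  linarith

lemma pow_le_mul_exp (n : ℕ) {c : ℝ} (hc : 0 < c) {x : ℝ} (hx : 0 ≤ x) :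
    x ^ n ≤ n.factorial / c ^ n * Real.exp (c * x) := by
  have := Real.pow_div_factorial_le_exp (c * x) (by positivity) n
  rw [div_le_iff₀ (by positivity), mul_pow] at this
  rw [div_mul_eq_mul_div, le_div_iff₀ (by positivity)]
  linarith

lemma integrable_cosh_pow_mul_exp (n : ℕ) {c : ℝ} (hc : 0 < c) :
    Integrable (fun t : ℝ => Real.cosh t ^ n * Real.exp (-c * Real.cosh t)) := by
  refine ((integrable_exp_neg_mul_sq (b := c / 8) (by positivity)).const_mul
    (n.factorial / (c / 2) ^ n)).mono' (by fun_prop) (ae_of_all _ fun t => ?_)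
  have hcosh := Real.cosh_pos t
  rw [Real.norm_of_nonneg (by positivity)]
  have h1 : t ^ 2 / 4 ≤ Real.cosh t := by
    rw [← Real.cosh_abs, Real.cosh_eq]
    have := Real.quadratic_le_exp_of_nonneg (abs_nonneg t)
    have := Real.exp_pos (-|t|)
    nlinarith [sq_abs t, abs_nonneg t]
  have h2 := pow_le_mul_exp n (half_pos hc) hcosh.le
  calc Real.cosh t ^ n * Real.exp (-c * Real.cosh t)
      ≤ n.factorial / (c / 2) ^ n * Real.exp (c / 2 * Real.cosh t)
          * Real.exp (-c * Real.cosh t) := by gcongr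
    _ = n.factorial / (c / 2) ^ n * Real.exp (-(c / 2) * Real.cosh t) := by
        rw [mul_assoc, ← Real.exp_add]; ring_nf
    _ ≤ n.factorial / (c / 2) ^ n * Real.exp (-(c / 8) * t ^ 2) := by
        refine mul_le_mul_of_nonneg_left (Real.exp_le_exp.2 ?_) (by positivity)
        nlinarith

lemma integrable_rotCosh_pow_mul_rotKernel {α w : ℝ} (hα : |α| ≤ 1 / 2) (hw : 0 < w)
    (n : ℕ) (τ : ℝ) : Integrable (fun t => rotCosh α t ^ n * rotKernel α w τ t) := by
  refine ((integrable_cosh_pow_mul_exp n (c := w / 4) (by positivity)).const_mul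
    (Real.exp (-(2 * τ * α)))).mono'
    (((continuous_rotCosh α).pow n).mul (continuous_rotKernel α w τ)).aestronglyMeasurable
    (ae_of_all _ fun t => ?_)
  rw [norm_mul, norm_pow, mul_left_comm]
  gcongr
  · exact norm_rotCosh_le α t
  · exact norm_rotKernel_le hα hw.le τ t

lemma hasDerivAt_rotCosh (α t : ℝ) : HasDerivAt (rotCosh α) (rotSinh α t) t := by
  have h : HasDerivAt (fun t : ℝ => (t : ℂ) + α * Complex.I) 1 t :=
    (Complex.ofRealCLM.hasDerivAt (x := t)).add_const _
  refine (((Complex.hasDerivAt_cosh _).comp t h).const_mul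
    (Complex.exp (Complex.I * (Real.pi : ℂ) / 4))).congr_deriv ?_
  rw [rotSinh, mul_one]

lemma hasDerivAt_rotSinh (α t : ℝ) : HasDerivAt (rotSinh α) (rotCosh α t) t := by
  have h : HasDerivAt (fun t : ℝ => (t : ℂ) + α * Complex.I) 1 t :=
    (Complex.ofRealCLM.hasDerivAt (x := t)).add_const _
  refine (((Complex.hasDerivAt_sinh _).comp t h).const_mul
    (Complex.exp (Complex.I * (Real.pi : ℂ) / 4))).congr_deriv ?_
  rw [rotCosh, mul_one]

lemma hasDerivAt_rotKernel (α w τ t : ℝ) : HasDerivAt (rotKernel α w τ)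
    ((-(w * rotSinh α t) + 2 * Complex.I * τ) * rotKernel α w τ t) t := by
  have h : HasDerivAt (fun t : ℝ => (t : ℂ) + α * Complex.I) 1 t :=
    (Complex.ofRealCLM.hasDerivAt (x := t)).add_const _
  refine ((((hasDerivAt_rotCosh α t).const_mul (w : ℂ)).neg).add
    (h.const_mul (2 * Complex.I * τ))).cexp.congr_deriv ?_
  simp only [rotKernel, Pi.add_apply, Pi.neg_apply]
  ring

lemma hasDerivAt_rotKernel_shift (α w τ t : ℝ) : HasDerivAt (fun α => rotKernel α w τ t)
    (Complex.I * ((-(w * rotSinh α t) + 2 * Complex.I * τ) * rotKernel α w τ t)) α := by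
  have h : HasDerivAt (fun α : ℝ => (t : ℂ) + α * Complex.I) Complex.I α := by
    simpa using ((Complex.ofRealCLM.hasDerivAt (x := α)).mul_const Complex.I).const_add (t : ℂ)
  have hc : HasDerivAt (fun α => rotCosh α t) (Complex.I * rotSinh α t) α := by
    refine (((Complex.hasDerivAt_cosh _).comp α h).const_mul
      (Complex.exp (Complex.I * (Real.pi : ℂ) / 4))).congr_deriv ?_
    rw [rotSinh]; ring
  refine (((hc.const_mul (w : ℂ)).neg).add
    (h.const_mul (2 * Complex.I * τ))).cexp.congr_deriv ?_
  simp only [rotKernel, Pi.add_apply, Pi.neg_apply]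
  ring

lemma norm_deriv_rotKernel_le {α w : ℝ} (hα : |α| ≤ 1 / 2) (hw : 0 ≤ w) (τ t : ℝ) :
    ‖(-(w * rotSinh α t) + 2 * Complex.I * τ) * rotKernel α w τ t‖
      ≤ Real.exp |τ| * (w * (Real.cosh t ^ 1 * Real.exp (-(w / 4) * Real.cosh t))
        + 2 * |τ| * (Real.cosh t ^ 0 * Real.exp (-(w / 4) * Real.cosh t))) := by
  have h1 : ‖-(w * rotSinh α t) + 2 * Complex.I * τ‖ ≤ w * Real.cosh t + 2 * |τ| := by
    refine (norm_add_le _ _).trans (add_le_add ?_ (by simp))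
    rw [norm_neg, norm_mul, Complex.norm_of_nonneg hw]
    exact mul_le_mul_of_nonneg_left (norm_rotSinh_le α t) hw
  have h2 : ‖rotKernel α w τ t‖ ≤ Real.exp |τ| * Real.exp (-(w / 4) * Real.cosh t) := by
    refine (norm_rotKernel_le hα hw τ t).trans ?_
    gcongr
    refine (neg_le_abs _).trans ?_
    rw [abs_mul, abs_mul, abs_two]
    nlinarith [abs_nonneg τ]
  have hcosh := Real.cosh_pos t
  calc _ ≤ (w * Real.cosh t + 2 * |τ|) *
        (Real.exp |τ| * Real.exp (-(w / 4) * Real.cosh t)) := by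
        rw [norm_mul]; gcongr
    _ = _ := by ring

lemma integrable_deriv_rotKernel_bound {w : ℝ} (hw : 0 < w) (τ : ℝ) :
    Integrable fun t : ℝ =>
      Real.exp |τ| * (w * (Real.cosh t ^ 1 * Real.exp (-(w / 4) * Real.cosh t))
        + 2 * |τ| * (Real.cosh t ^ 0 * Real.exp (-(w / 4) * Real.cosh t))) :=
  (((integrable_cosh_pow_mul_exp 1 (c := w / 4) (by positivity)).const_mul w).add
    ((integrable_cosh_pow_mul_exp 0 (c := w / 4) (by positivity)).const_mul (2 * |τ|))).const_mul _

lemma continuous_rotSinh (α : ℝ) : Continuous (rotSinh α) := by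
  unfold rotSinh; fun_prop

lemma integrable_rotKernel {α w : ℝ} (hα : |α| ≤ 1 / 2) (hw : 0 < w) (τ : ℝ) :
    Integrable (rotKernel α w τ) := by
  simpa using integrable_rotCosh_pow_mul_rotKernel hα hw 0 τ

lemma integrable_deriv_rotKernel {α w : ℝ} (hα : |α| ≤ 1 / 2) (hw : 0 < w) (τ : ℝ) :
    Integrable fun t => (-(w * rotSinh α t) + 2 * Complex.I * τ) * rotKernel α w τ t := by
  have := continuous_rotSinh α
  have := continuous_rotKernel α w τ
  exact (integrable_deriv_rotKernel_bound hw τ).mono' (by fun_prop)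
    (ae_of_all _ fun t => norm_deriv_rotKernel_le hα hw.le τ t)

/-- The integral of `rotKernel` does not change when the contour is shifted. -/
lemma integral_rotKernel_shift {w : ℝ} (hw : 0 < w) (τ : ℝ) :
    ∫ t, rotKernel (1 / 4) w τ t = ∫ t, rotKernel 0 w τ t := by
  set s : Set ℝ := Ioo (-(1 / 2)) (1 / 2) with hs
  have habs : ∀ α ∈ s, |α| ≤ 1 / 2 := fun α hα => abs_le.2 ⟨hα.1.le, hα.2.le⟩
  have key : ∀ α ∈ s, HasDerivAt (fun α => ∫ t, rotKernel α w τ t) 0 α := by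
    intro α hα
    have hF' := integrable_deriv_rotKernel (habs α hα) hw τ
    have hd := (hasDerivAt_integral_of_dominated_loc_of_deriv_le (μ := volume)
      (F := fun α t => rotKernel α w τ t) (x₀ := α) (s := s)
      (F' := fun α t => Complex.I * ((-(w * rotSinh α t) + 2 * Complex.I * τ) * rotKernel α w τ t))
      (isOpen_Ioo.mem_nhds hα)
      (Eventually.of_forall fun α => (continuous_rotKernel α w τ).aestronglyMeasurable)
      (integrable_rotKernel (habs α hα) hw τ)
      (by exact (hF'.const_mul _).aestronglyMeasurable)
      (ae_of_all _ fun t α hα => by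
        rw [norm_mul, Complex.norm_I, one_mul]
        exact norm_deriv_rotKernel_le (habs α hα) hw.le τ t)
      (integrable_deriv_rotKernel_bound hw τ)
      (ae_of_all _ fun t α _ => hasDerivAt_rotKernel_shift α w τ t)).2
    have hz : ∫ t, (-(w * rotSinh α t) + 2 * Complex.I * τ) * rotKernel α w τ t = 0 :=
      integral_eq_zero_of_hasDerivAt_of_integrable (hasDerivAt_rotKernel α w τ) hF'
        (integrable_rotKernel (habs α hα) hw τ)
    rwa [integral_const_mul, hz, mul_zero] at hd
  refine isOpen_Ioo.is_const_of_deriv_eq_zero isPreconnected_Ioo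
    (fun α hα => (key α hα).differentiableAt.differentiableWithinAt)
    (fun α hα => (key α hα).deriv) (x := 1 / 4) (y := 0) ?_ ?_ <;> norm_num

/-- `K_{2iτ}(w e^{iπ/4})` as an integral over the real line. -/
lemma besselK_eq_integral_rotKernel {w : ℝ} (hw : 0 < w) (τ : ℝ) :
    besselK (2 * Complex.I * τ) (w * Complex.exp (Complex.I * (Real.pi : ℂ) / 4))
      = (1 / 2) * ∫ t, rotKernel (1 / 4) w τ t := by
  have hint := integrable_rotKernel (α := 0) (by norm_num) hw τ
  have hneg := integral_comp_neg_Iic 0 (fun t => rotKernel 0 w τ (-t))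
  simp only [neg_neg, neg_zero] at hneg
  rw [integral_rotKernel_shift hw, ← intervalIntegral.integral_Iic_add_Ioi hint.integrableOn
    hint.integrableOn (b := 0), hneg,
    ← integral_add hint.comp_neg.integrableOn hint.integrableOn, ← integral_const_mul, besselK]
  refine integral_congr_ae (ae_of_all _ fun t => ?_)
  have hcosh : Complex.cosh (2 * Complex.I * τ * t) = (Complex.exp (2 * Complex.I * τ * t)
    + Complex.exp (-(2 * Complex.I * τ * t))) / 2 := rfl
  simp only [rotKernel, rotCosh, hcosh, Complex.ofReal_zero, zero_mul, add_zero,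
    Complex.ofReal_neg, Complex.cosh_neg, Complex.ofReal_cosh, Complex.exp_add]
  rw [show -((w : ℂ) * (Complex.exp (Complex.I * (Real.pi : ℂ) / 4) * Complex.cosh t))
    = -(w * Complex.exp (Complex.I * (Real.pi : ℂ) / 4)) * Complex.cosh t by ring,
    show 2 * Complex.I * τ * -(t : ℂ) = -(2 * Complex.I * τ * t) by ring]
  ring

lemma besselK_conj (z : ℂ) (τ : ℝ) :
    besselK (2 * Complex.I * τ) ((starRingEnd ℂ) z)
      = (starRingEnd ℂ) (besselK (2 * Complex.I * τ) z) := by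
  rw [besselK, besselK, ← integral_conj]
  refine integral_congr_ae (ae_of_all _ fun t => ?_)
  have : 2 * Complex.I * τ * t = ((2 * τ * t : ℝ) : ℂ) * Complex.I := by push_cast; ring
  simp only [this, Complex.cosh_mul_I, ← Complex.ofReal_cos, map_mul, ← Complex.exp_conj, map_neg,
    Complex.conj_ofReal]

/-- `kernelK` is the squared modulus of `K_{2iτ}(2 (4x)^{1/4} e^{iπ/4})`. -/
lemma kernelK_eq_normSq {x : ℝ} (hx : 0 < x) (τ : ℝ) :
    kernelK x τ
      = Complex.normSq ((1 / 2) * ∫ t, rotKernel (1 / 4) (2 * (4 * x) ^ ((1 : ℝ) / 4)) τ t) := by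
  have hconj : ((2 * (4 * x) ^ ((1 : ℝ) / 4) : ℝ) : ℂ)
        * Complex.exp (-(Complex.I * (Real.pi : ℂ)) / 4)
      = (starRingEnd ℂ) (((2 * (4 * x) ^ ((1 : ℝ) / 4) : ℝ) : ℂ)
        * Complex.exp (Complex.I * (Real.pi : ℂ) / 4)) := by
    rw [map_mul, Complex.conj_ofReal, ← Complex.exp_conj, map_div₀, map_mul, Complex.conj_I,
      Complex.conj_ofReal, Complex.conj_ofNat, neg_mul]
  rw [kernelK, hconj, besselK_conj, Complex.mul_conj, Complex.ofReal_re,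
    besselK_eq_integral_rotKernel (by positivity)]

/-- The moments `∫ γ(t)ⁿ exp (-w γ(t) + 2iτ (t + i/4)) dt`, `γ(t) = e^{iπ/4} cosh (t + i/4)`;
up to sign they are the `w`-derivatives of `2 K_{2iτ}(w e^{iπ/4})`. -/
noncomputable def rotMoment (n : ℕ) (w τ : ℝ) : ℂ :=
  ∫ t, rotCosh (1 / 4) t ^ n * rotKernel (1 / 4) w τ t

lemma norm_rotCosh_pow_mul_rotKernel_le {v w : ℝ} (hv : 0 ≤ v) (hvw : v ≤ w) (n : ℕ) (τ t : ℝ) :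
    ‖rotCosh (1 / 4) t ^ n * rotKernel (1 / 4) w τ t‖
      ≤ Real.exp (-(τ / 2)) * (Real.cosh t ^ n * Real.exp (-(v / 4) * Real.cosh t)) := by
  have hcosh := Real.cosh_pos t
  have h := norm_rotKernel_le (α := 1 / 4) (by norm_num [abs_of_pos]) (hv.trans hvw) τ t
  rw [show 2 * τ * (1 / 4) = τ / 2 by ring] at h
  rw [norm_mul, norm_pow, mul_left_comm]
  gcongr
  · exact norm_rotCosh_le _ t
  · refine h.trans ?_
    gcongr

lemma norm_rotMoment_le {v w : ℝ} (hv : 0 < v) (hvw : v ≤ w) (n : ℕ) (τ : ℝ) :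
    ‖rotMoment n w τ‖ ≤ Real.exp (-(τ / 2))
      * ∫ t, Real.cosh t ^ n * Real.exp (-(v / 4) * Real.cosh t) := by
  rw [← integral_const_mul]
  exact norm_integral_le_of_norm_le
    ((integrable_cosh_pow_mul_exp n (by positivity)).const_mul _)
    (ae_of_all _ fun t => norm_rotCosh_pow_mul_rotKernel_le hv.le hvw n τ t)

lemma measurable_rotMoment (n : ℕ) (w : ℝ) : Measurable (rotMoment n w) := by
  have hc : Continuous (Function.uncurry fun τ t : ℝ =>
      rotCosh (1 / 4) t ^ n * rotKernel (1 / 4) w τ t) := by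
    unfold Function.uncurry rotKernel rotCosh
    fun_prop
  exact hc.stronglyMeasurable.integral_prod_right.measurable

lemma hasDerivAt_rotMoment (n : ℕ) {w : ℝ} (hw : 0 < w) (τ : ℝ) :
    HasDerivAt (fun w => rotMoment n w τ) (-rotMoment (n + 1) w τ) w := by
  have hcont : ∀ (n : ℕ) (w : ℝ),
      Continuous fun t => rotCosh (1 / 4) t ^ n * rotKernel (1 / 4) w τ t := fun n w =>
    ((continuous_rotCosh _).pow n).mul (continuous_rotKernel _ w τ)
  have hd := (hasDerivAt_integral_of_dominated_loc_of_deriv_le (μ := volume)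
    (F := fun w t => rotCosh (1 / 4) t ^ n * rotKernel (1 / 4) w τ t) (x₀ := w) (s := Ioi (w / 2))
    (F' := fun w t => -(rotCosh (1 / 4) t ^ (n + 1) * rotKernel (1 / 4) w τ t))
    (Ioi_mem_nhds (by linarith))
    (Eventually.of_forall fun w => (hcont n w).aestronglyMeasurable)
    (integrable_rotCosh_pow_mul_rotKernel (by norm_num [abs_of_pos]) hw n τ)
    (by exact (hcont (n + 1) w).neg.aestronglyMeasurable)
    (ae_of_all _ fun t v hv => by
      rw [norm_neg]
      exact norm_rotCosh_pow_mul_rotKernel_le (by positivity) (le_of_lt hv) (n + 1) τ t)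
    ((integrable_cosh_pow_mul_exp (n + 1) (by positivity)).const_mul _)
    (ae_of_all _ fun t v _ => ?_)).2
  · rwa [integral_neg] at hd
  · have h : HasDerivAt (fun v : ℝ => -((v : ℂ) * rotCosh (1 / 4) t)
        + 2 * Complex.I * τ * (t + ((1 / 4 : ℝ) : ℂ) * Complex.I)) (-(1 * rotCosh (1 / 4) t)) v :=
      ((Complex.ofRealCLM.hasDerivAt (x := v)).mul_const _).neg.add_const _
    refine (h.cexp.const_mul (rotCosh (1 / 4) t ^ n)).congr_deriv ?_
    rw [rotKernel]
    ring

/-- The modified Bessel equation, in terms of the moments. -/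
lemma rotMoment_bessel {w : ℝ} (hw : 0 < w) (τ : ℝ) :
    (w : ℂ) ^ 2 * rotMoment 2 w τ - w * rotMoment 1 w τ
      = (Complex.I * w ^ 2 - 4 * τ ^ 2) * rotMoment 0 w τ := by
  have hα : |(1 / 4 : ℝ)| ≤ 1 / 2 := by norm_num [abs_of_pos]
  have hint := fun n => integrable_rotCosh_pow_mul_rotKernel hα hw n τ
  have hder : ∀ t, HasDerivAt
      (fun t => -((-(w * rotSinh (1 / 4) t) + 2 * Complex.I * τ) * rotKernel (1 / 4) w τ t)
        + 4 * Complex.I * τ * rotKernel (1 / 4) w τ t)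
      (w * (rotCosh (1 / 4) t ^ 1 * rotKernel (1 / 4) w τ t)
        - w ^ 2 * (rotCosh (1 / 4) t ^ 2 * rotKernel (1 / 4) w τ t)
        + (Complex.I * w ^ 2 - 4 * τ ^ 2)
          * (rotCosh (1 / 4) t ^ 0 * rotKernel (1 / 4) w τ t)) t := by
    intro t
    have hk := hasDerivAt_rotKernel (1 / 4) w τ t
    have hsq : rotSinh (1 / 4) t ^ 2 = rotCosh (1 / 4) t ^ 2 - Complex.I := by
      rw [rotSinh, rotCosh, mul_pow, mul_pow, exp_I_pi_div_four_sq, Complex.cosh_sq]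
      ring
    refine (((((hasDerivAt_rotSinh (1 / 4) t).const_mul (w : ℂ)).neg.add_const
      (2 * Complex.I * τ)).mul hk).neg.add (hk.const_mul (4 * Complex.I * τ))).congr_deriv ?_
    simp only [Pi.neg_apply]
    linear_combination (-(w : ℂ) ^ 2 * rotKernel (1 / 4) w τ t) * hsq
      + (4 * τ ^ 2 * rotKernel (1 / 4) w τ t) * Complex.I_sq
  have hF : Integrable fun t =>
      -((-(w * rotSinh (1 / 4) t) + 2 * Complex.I * τ) * rotKernel (1 / 4) w τ t)
        + 4 * Complex.I * τ * rotKernel (1 / 4) w τ t :=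
    (integrable_deriv_rotKernel hα hw τ).neg.add ((integrable_rotKernel hα hw τ).const_mul _)
  have h0 := (hint 0).const_mul (Complex.I * (w : ℂ) ^ 2 - 4 * τ ^ 2)
  have h1 := (hint 1).const_mul (w : ℂ)
  have h2 := (hint 2).const_mul ((w : ℂ) ^ 2)
  have hz := integral_eq_zero_of_hasDerivAt_of_integrable hder ((h1.sub h2).add h0) hF
  rw [integral_add (by exact h1.sub h2) h0, integral_sub h1 h2, integral_const_mul,
    integral_const_mul, integral_const_mul] at hz
  simp only [rotMoment]
  linear_combination -hz

/-- The argument `2 (4r)^{1/4}` of the Bessel functions in `kernelK`. -/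
noncomputable def radialArg (r : ℝ) : ℝ := 2 * (4 * r) ^ ((1 : ℝ) / 4)

lemma radialArg_pos {r : ℝ} (hr : 0 < r) : 0 < radialArg r := by
  unfold radialArg; positivity

lemma radialArg_mono {r s : ℝ} (hr : 0 < r) (hrs : r ≤ s) : radialArg r ≤ radialArg s := by
  unfold radialArg
  gcongr

lemma radialArg_sq {r : ℝ} (hr : 0 < r) : radialArg r ^ 2 = 8 * √r := by
  rw [radialArg, mul_pow, ← Real.rpow_natCast (_ ^ _), ← Real.rpow_mul (by positivity),
    show (1 : ℝ) / 4 * (2 : ℕ) = 1 / 2 by norm_num, ← Real.sqrt_eq_rpow,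
    Real.sqrt_mul (by norm_num), show √(4 : ℝ) = 2 by
      rw [show (4 : ℝ) = 2 ^ 2 by norm_num, Real.sqrt_sq (by norm_num)]]
  ring

lemma hasDerivAt_radialArg {r : ℝ} (hr : 0 < r) :
    HasDerivAt radialArg (radialArg r / (4 * r)) r := by
  have h := (((hasDerivAt_id r).const_mul 4).rpow_const (p := 1 / 4)
    (Or.inl (by simp [hr.ne']))).const_mul 2
  refine h.congr_deriv ?_
  rw [radialArg, Real.rpow_sub_one (by simp [hr.ne'])]
  simp only [id]
  field_simp

/-- `K_{2iτ}(2 (4r)^{1/4} e^{iπ/4})`. -/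
noncomputable def radialVal (r τ : ℝ) : ℂ := (1 / 2) * rotMoment 0 (radialArg r) τ

/-- The image of `radialVal` under the Euler operator `r d/dr`. -/
noncomputable def radialEuler (r τ : ℝ) : ℂ :=
  -((radialArg r : ℂ) / 8) * rotMoment 1 (radialArg r) τ

lemma kernelK_eq {r : ℝ} (hr : 0 < r) (τ : ℝ) :
    kernelK r τ = (radialVal r τ).re ^ 2 + (radialVal r τ).im ^ 2 := by
  rw [kernelK_eq_normSq hr, Complex.normSq_apply, ← sq, ← sq]
  simp [radialVal, rotMoment, radialArg]

lemma hasDerivAt_rotMoment_radialArg (n : ℕ) {r : ℝ} (hr : 0 < r) (τ : ℝ) :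
    HasDerivAt (fun r => rotMoment n (radialArg r) τ)
      (((radialArg r / (4 * r) : ℝ) : ℂ) * -rotMoment (n + 1) (radialArg r) τ) r :=
  ((hasDerivAt_rotMoment n (radialArg_pos hr) τ).scomp r (hasDerivAt_radialArg hr)).congr_deriv
    (Complex.real_smul)

lemma hasDerivAt_radialVal {r : ℝ} (hr : 0 < r) (τ : ℝ) :
    HasDerivAt (fun r => radialVal r τ) (radialEuler r τ / r) r := by
  refine ((hasDerivAt_rotMoment_radialArg 0 hr τ).const_mul (1 / 2)).congr_deriv ?_
  have : (r : ℂ) ≠ 0 := by exact_mod_cast hr.ne'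
  rw [radialEuler]
  push_cast
  field_simp
  ring

lemma hasDerivAt_radialEuler {r : ℝ} (hr : 0 < r) (τ : ℝ) :
    HasDerivAt (fun r => radialEuler r τ)
      ((-((τ ^ 2 / 4 : ℝ) : ℂ) + ((√r / 2 : ℝ) : ℂ) * Complex.I) * radialVal r τ / r) r := by
  refine (((hasDerivAt_radialArg hr).ofReal_comp.div_const 8).neg.mul
    (hasDerivAt_rotMoment_radialArg 1 hr τ)).congr_deriv ?_
  have h0 : (r : ℂ) ≠ 0 := by exact_mod_cast hr.ne'
  have hb := rotMoment_bessel (radialArg_pos hr) τ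
  have hsq : (radialArg r : ℂ) ^ 2 = 8 * (√r : ℂ) := by exact_mod_cast radialArg_sq hr
  rw [radialVal]
  simp only [Pi.neg_apply]
  push_cast
  field_simp
  linear_combination 4 * hb + 4 * Complex.I * rotMoment 0 (radialArg r) τ * hsq

lemma hasDerivAt_integral_mul_of_bounded {g : ℝ → ℝ} (hg : IntegrableOn g (Ioi 0))
    {F F' : ℝ → ℝ → ℝ} {x C : ℝ} {s : Set ℝ} (hs : s ∈ nhds x)
    (hF : ∀ y ∈ s, Measurable (F y)) (hF' : Measurable (F' x))
    (hFC : ∀ τ > 0, |F x τ| ≤ C) (hFC' : ∀ y ∈ s, ∀ τ > 0, |F' y τ| ≤ C)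
    (hd : ∀ y ∈ s, ∀ τ > 0, HasDerivAt (fun y => F y τ) (F' y τ) y) :
    HasDerivAt (fun y => ∫ τ in Ioi 0, F y τ * g τ) (∫ τ in Ioi 0, F' x τ * g τ) x := by
  have hpos : ∀ᵐ τ ∂(volume.restrict (Ioi (0 : ℝ))), 0 < τ := ae_restrict_mem measurableSet_Ioi
  refine (hasDerivAt_integral_of_dominated_loc_of_deriv_le (μ := volume.restrict (Ioi (0 : ℝ)))
    (bound := fun τ => C * ‖g τ‖) hs
    (eventually_of_mem hs fun y hy => (hF y hy).aestronglyMeasurable.mul hg.aestronglyMeasurable)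
    (Integrable.bdd_mul hg (hF x (mem_of_mem_nhds hs)).aestronglyMeasurable
      (hpos.mono fun τ hτ => hFC τ hτ))
    (hF'.aestronglyMeasurable.mul hg.aestronglyMeasurable)
    (hpos.mono fun τ hτ y hy => ?_) (hg.norm.const_mul C)
    (hpos.mono fun τ hτ y hy => (hd y hy τ hτ).mul_const _)).2
  rw [norm_mul]
  exact mul_le_mul_of_nonneg_right (hFC' y hy τ hτ) (norm_nonneg _)

/-- The iterated images of `kernelK` under the Euler operator `r d/dr`. -/
noncomputable def radialFamily : ℕ → ℝ → ℝ → ℝ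
  | 0, r, τ => (radialVal r τ).re ^ 2 + (radialVal r τ).im ^ 2
  | 1, r, τ => 2 * ((radialVal r τ).re * (radialEuler r τ).re
      + (radialVal r τ).im * (radialEuler r τ).im)
  | 2, r, τ => 2 * ((radialEuler r τ).re ^ 2 + (radialEuler r τ).im ^ 2)
      - τ ^ 2 / 2 * ((radialVal r τ).re ^ 2 + (radialVal r τ).im ^ 2)
  | 3, r, τ => -2 * τ ^ 2 * ((radialVal r τ).re * (radialEuler r τ).re
      + (radialVal r τ).im * (radialEuler r τ).im)
      - 2 * √r * ((radialVal r τ).im * (radialEuler r τ).re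
      - (radialVal r τ).re * (radialEuler r τ).im)
  | _, r, τ => -2 * τ ^ 2 * ((radialEuler r τ).re ^ 2 + (radialEuler r τ).im ^ 2)
      + (τ ^ 4 / 2 + r) * ((radialVal r τ).re ^ 2 + (radialVal r τ).im ^ 2)
      - √r * ((radialVal r τ).im * (radialEuler r τ).re
      - (radialVal r τ).re * (radialEuler r τ).im)

lemma radialFamily_ode (r τ : ℝ) :
    radialFamily 4 r τ - 1 / 2 * radialFamily 3 r τ
      + τ ^ 2 * (radialFamily 2 r τ - 1 / 2 * radialFamily 1 r τ) = r * radialFamily 0 r τ := by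
  simp only [radialFamily]
  ring

lemma hasDerivAt_radialFamily {j : ℕ} (hj : j < 4) {r : ℝ} (hr : 0 < r) (τ : ℝ) :
    HasDerivAt (fun r => radialFamily j r τ) (radialFamily (j + 1) r τ / r) r := by
  have hre : ∀ {f : ℝ → ℂ} {f' : ℂ}, HasDerivAt f f' r → HasDerivAt (fun r => (f r).re) f'.re r :=
    fun h => Complex.reCLM.hasFDerivAt.comp_hasDerivAt r h
  have him : ∀ {f : ℝ → ℂ} {f' : ℂ}, HasDerivAt f f' r → HasDerivAt (fun r => (f r).im) f'.im r :=
    fun h => Complex.imCLM.hasFDerivAt.comp_hasDerivAt r h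
  have hp := hre (hasDerivAt_radialVal hr τ)
  have hq := him (hasDerivAt_radialVal hr τ)
  have hx := hre (hasDerivAt_radialEuler hr τ)
  have hy := him (hasDerivAt_radialEuler hr τ)
  have hs : HasDerivAt (fun r => √r) (√r / (2 * r)) r := by
    refine (Real.hasDerivAt_sqrt hr.ne').congr_deriv ?_
    rw [div_eq_div_iff (by positivity) (by positivity)]
    nlinarith [Real.mul_self_sqrt hr.le]
  have hss := Real.mul_self_sqrt hr.le
  simp only [Complex.div_ofReal_re, Complex.div_ofReal_im, Complex.mul_re, Complex.mul_im,
    Complex.add_re, Complex.add_im, Complex.neg_re, Complex.neg_im, Complex.ofReal_re,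
    Complex.ofReal_im, Complex.I_re, Complex.I_im, mul_zero, mul_one, zero_add,
    add_zero, sub_zero, neg_zero] at hp hq hx hy
  interval_cases j
  · refine ((hp.pow 2).add (hq.pow 2)).congr_deriv ?_
    simp only [radialFamily]
    field_simp
    push_cast
    ring
  · refine (((hp.mul hx).add (hq.mul hy)).const_mul 2).congr_deriv ?_
    simp only [radialFamily]
    field_simp
    ring
  · refine ((((hx.pow 2).add (hy.pow 2)).const_mul 2).sub
      (((hp.pow 2).add (hq.pow 2)).const_mul (τ ^ 2 / 2))).congr_deriv ?_
    simp only [radialFamily]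
    field_simp
    push_cast
    ring
  · refine ((((hp.mul hx).add (hq.mul hy)).const_mul (-2 * τ ^ 2)).sub
      ((hs.const_mul 2).mul ((hq.mul hx).sub (hp.mul hy)))).congr_deriv ?_
    simp only [radialFamily, Pi.mul_apply, Pi.sub_apply]
    field_simp
    ring_nf
    simp only [Real.sq_sqrt hr.le]
    ring

lemma measurable_radialFamily (j : ℕ) (r : ℝ) : Measurable (radialFamily j r) := by
  have ha : Measurable (radialVal r) := (measurable_rotMoment 0 _).const_mul _
  have hb : Measurable (radialEuler r) := (measurable_rotMoment 1 _).const_mul _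
  have hp : Measurable fun τ => (radialVal r τ).re := Complex.measurable_re.comp ha
  have hq : Measurable fun τ => (radialVal r τ).im := Complex.measurable_im.comp ha
  have hx : Measurable fun τ => (radialEuler r τ).re := Complex.measurable_re.comp hb
  have hy : Measurable fun τ => (radialEuler r τ).im := Complex.measurable_im.comp hb
  have h0 := (hp.pow_const 2).add (hq.pow_const 2)
  have h1 := (hp.mul hx).add (hq.mul hy)
  have h2 := (hx.pow_const 2).add (hy.pow_const 2)
  have h3 := (hq.mul hx).sub (hp.mul hy)
  have ht : Measurable fun τ : ℝ => τ := measurable_id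
  rcases j with _ | _ | _ | _ | j
  · exact h0
  · exact h1.const_mul 2
  · exact (h2.const_mul 2).sub (((ht.pow_const 2).div_const 2).mul h0)
  · exact (((ht.pow_const 2).const_mul (-2)).mul h1).sub (h3.const_mul (2 * √r))
  · exact ((((ht.pow_const 2).const_mul (-2)).mul h2).add
      ((((ht.pow_const 4).div_const 2).add_const r).mul h0)).sub (h3.const_mul (√r))

lemma norm_radial_le {r : ℝ} (hr : 0 < r) : ∃ C : ℝ, ∀ s ∈ Icc (r / 2) (2 * r), ∀ τ : ℝ,
    ‖radialVal s τ‖ ≤ C * Real.exp (-(τ / 2)) ∧ ‖radialEuler s τ‖ ≤ C * Real.exp (-(τ / 2)) := by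
  set v := radialArg (r / 2)
  have hv : 0 < v := radialArg_pos (by positivity)
  set N : ℕ → ℝ := fun n => ∫ t, Real.cosh t ^ n * Real.exp (-(v / 4) * Real.cosh t)
  have hN : ∀ n, 0 ≤ N n := fun n => integral_nonneg fun t => by
    have := Real.cosh_pos t
    positivity
  have hw := radialArg_pos (r := 2 * r) (by positivity)
  refine ⟨max (1 / 2 * N 0) (radialArg (2 * r) / 8 * N 1), fun s hs τ => ?_⟩
  have hs0 : 0 < s := by linarith [hs.1]
  have hvs : v ≤ radialArg s := radialArg_mono (by positivity) hs.1
  have hsw : radialArg s ≤ radialArg (2 * r) := radialArg_mono hs0 hs.2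
  have h0 := norm_rotMoment_le hv hvs 0 τ
  have h1 := norm_rotMoment_le hv hvs 1 τ
  have hE := Real.exp_pos (-(τ / 2))
  constructor
  · refine le_trans ?_ (mul_le_mul_of_nonneg_right (le_max_left _ _) hE.le)
    rw [radialVal, norm_mul, show ‖(1 / 2 : ℂ)‖ = 1 / 2 by norm_num]
    linarith
  · refine le_trans ?_ (mul_le_mul_of_nonneg_right (le_max_right _ _) hE.le)
    have h8 : ‖-((radialArg s : ℂ) / 8)‖ ≤ radialArg (2 * r) / 8 := by
      rw [norm_neg, norm_div, Complex.norm_of_nonneg (radialArg_pos hs0).le]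
      norm_num
      linarith
    rw [radialEuler, norm_mul]
    calc _ ≤ radialArg (2 * r) / 8 * (Real.exp (-(τ / 2)) * N 1) := by gcongr
      _ = _ := by ring

lemma radialFamily_le (j : ℕ) {r : ℝ} (hr : 0 < r) : ∃ C : ℝ, 0 ≤ C ∧
    ∀ s ∈ Icc (r / 2) (2 * r), ∀ τ > 0, |radialFamily j s τ| ≤ C * Real.exp (-(τ / 2)) := by
  obtain ⟨C, hC⟩ := norm_radial_le hr
  refine ⟨(4 + 4 * √(2 * r) + 2 * (2 * r)) * C ^ 2 * (24 / (1 / 2) ^ 4 * Real.exp (1 / 2)),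
    by positivity, fun s hs τ hτ => ?_⟩
  have hs0 : 0 < s := by linarith [hs.1]
  obtain ⟨ha, hb⟩ := hC s hs τ
  set B := C * Real.exp (-(τ / 2))
  have hB : 0 ≤ B := (norm_nonneg _).trans ha
  have hp := (Complex.abs_re_le_norm _).trans ha
  have hq := (Complex.abs_im_le_norm _).trans ha
  have hx := (Complex.abs_re_le_norm _).trans hb
  have hy := (Complex.abs_im_le_norm _).trans hb
  have hmul : ∀ {u v : ℝ}, |u| ≤ B → |v| ≤ B → |u * v| ≤ B ^ 2 := fun hu hv => by
    rw [abs_mul, sq]; gcongr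
  have hpoly : |radialFamily j s τ| ≤ (4 + 4 * τ ^ 2 + τ ^ 4 + 4 * √s + 2 * s) * B ^ 2 := by
    have hadd : ∀ {u v : ℝ}, |u| ≤ B ^ 2 → |v| ≤ B ^ 2 → |u + v| ≤ 2 * B ^ 2 := fun hu hv => by
      linarith [abs_add_le _ _ |>.trans (add_le_add hu hv)]
    have hsub : ∀ {u v : ℝ}, |u| ≤ B ^ 2 → |v| ≤ B ^ 2 → |u - v| ≤ 2 * B ^ 2 := fun hu hv => by
      linarith [abs_sub _ _ |>.trans (add_le_add hu hv)]
    have h0 := hadd (hmul hp hp) (hmul hq hq)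
    have h1 := hadd (hmul hp hx) (hmul hq hy)
    have h2 := hadd (hmul hx hx) (hmul hy hy)
    have h3 := hsub (hmul hq hx) (hmul hp hy)
    simp only [← sq] at h0 h2
    have hweight : ∀ {c u : ℝ}, 0 ≤ c → |u| ≤ 2 * B ^ 2 →
        -(c * (2 * B ^ 2)) ≤ c * u ∧ c * u ≤ c * (2 * B ^ 2) := fun hc hu =>
      ⟨by nlinarith [(abs_le.1 hu).1], by nlinarith [(abs_le.1 hu).2]⟩
    have hX := sq_nonneg B
    have ht2 : 0 ≤ τ ^ 2 := sq_nonneg τ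
    have ht4 : 0 ≤ τ ^ 4 := by positivity
    have hsq := Real.sqrt_nonneg s
    have h0' := abs_le.1 h0
    have h1' := abs_le.1 h1
    have h2' := abs_le.1 h2
    have h3' := abs_le.1 h3
    have k1 := mul_nonneg ht2 hX
    have k2 := mul_nonneg ht4 hX
    have k3 := mul_nonneg hsq hX
    have k4 := mul_nonneg hs0.le hX
    have m1 := hweight ht2 h0
    have m2 := hweight ht2 h1
    have m3 := hweight ht2 h2
    have m4 := hweight ht4 h0
    have m5 := hweight hs0.le h0
    have m6 := hweight hsq h3
    rcases j with _ | _ | _ | _ | j <;> simp only [radialFamily] <;> refine abs_le.2 ⟨?_, ?_⟩ <;>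
      linarith
  have hcoef : 4 + 4 * τ ^ 2 + τ ^ 4 + 4 * √s + 2 * s
      ≤ (4 + 4 * √(2 * r) + 2 * (2 * r)) * (1 + τ) ^ 4 := by
    have h1 : √s ≤ √(2 * r) := Real.sqrt_le_sqrt hs.2
    have h2 := hs.2
    have h3 : 1 + τ ^ 2 + τ ^ 4 ≤ (1 + τ) ^ 4 := by
      have : 0 ≤ 4 * τ + 5 * τ ^ 2 + 4 * τ ^ 3 := by positivity
      linarith
    have h4 : 1 ≤ (1 + τ) ^ 4 := by nlinarith [sq_nonneg τ, sq_nonneg (τ ^ 2)]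
    have h5 : 0 ≤ 4 * √(2 * r) + 2 * (2 * r) := by positivity
    nlinarith [mul_nonneg h5 (sub_nonneg.2 h4), sq_nonneg (τ ^ 2)]
  have hexp := pow_le_mul_exp 4 (c := 1 / 2) (by norm_num) (x := 1 + τ) (by linarith)
  have hE : Real.exp (1 / 2 * (1 + τ)) * (Real.exp (-(τ / 2)) * Real.exp (-(τ / 2)))
      = Real.exp (1 / 2) * Real.exp (-(τ / 2)) := by
    rw [← Real.exp_add, ← Real.exp_add, ← Real.exp_add]; ring_nf
  have hfac : ((Nat.factorial 4 : ℕ) : ℝ) = 24 := by norm_num [Nat.factorial]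
  rw [hfac] at hexp
  calc |radialFamily j s τ| ≤ (4 + 4 * τ ^ 2 + τ ^ 4 + 4 * √s + 2 * s) * B ^ 2 := hpoly
    _ ≤ (4 + 4 * √(2 * r) + 2 * (2 * r)) * (24 / (1 / 2) ^ 4 * Real.exp (1 / 2 * (1 + τ)))
        * B ^ 2 := by
        gcongr
        exact hcoef.trans (by gcongr)
    _ = (4 + 4 * √(2 * r) + 2 * (2 * r)) * C ^ 2 * (24 / (1 / 2) ^ 4)
        * (Real.exp (1 / 2 * (1 + τ)) * (Real.exp (-(τ / 2)) * Real.exp (-(τ / 2)))) := by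
        simp only [B]; ring
    _ = _ := by rw [hE]; ring

/-- The ratio `sinh (φτ) / sinh (βτ)` and its first two derivatives in `φ`. -/
noncomputable def angularFamily (β : ℝ) : ℕ → ℝ → ℝ → ℝ
  | 0, φ, τ => Real.sinh (φ * τ) / Real.sinh (β * τ)
  | 1, φ, τ => τ * Real.cosh (φ * τ) / Real.sinh (β * τ)
  | _, φ, τ => τ ^ 2 * (Real.sinh (φ * τ) / Real.sinh (β * τ))

lemma measurable_angularFamily (β : ℝ) (m : ℕ) (φ : ℝ) : Measurable (angularFamily β m φ) := by
  rcases m with _ | _ | m <;> (unfold angularFamily; fun_prop)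

lemma hasDerivAt_angularFamily (β : ℝ) {m : ℕ} (hm : m < 2) (φ τ : ℝ) :
    HasDerivAt (fun φ => angularFamily β m φ τ) (angularFamily β (m + 1) φ τ) φ := by
  have h : HasDerivAt (fun φ : ℝ => φ * τ) τ φ := by
    simpa using (hasDerivAt_id φ).mul_const τ
  interval_cases m
  · refine (h.sinh.div_const _).congr_deriv ?_
    simp only [angularFamily]
    ring
  · refine ((h.cosh.const_mul τ).div_const _).congr_deriv ?_
    simp only [angularFamily]
    ring

lemma abs_sinh_le (x : ℝ) : |Real.sinh x| ≤ |x| * Real.cosh x := by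
  have h := (convex_Icc (-|x|) |x|).norm_image_sub_le_of_norm_hasDerivWithin_le
    (f := Real.sinh) (f' := Real.cosh) (C := Real.cosh x) (x := 0) (y := x)
    (fun y _ => (Real.hasDerivAt_sinh y).hasDerivWithinAt)
    (fun y hy => by
      rw [Real.norm_of_nonneg (Real.cosh_pos y).le, Real.cosh_le_cosh]
      exact abs_le.2 hy)
    (by simp) ⟨neg_abs_le x, le_abs_self x⟩
  simpa [mul_comm] using h

lemma angularFamily_le {β : ℝ} (hβ : 0 < β) (m : ℕ) : ∃ C : ℝ, 0 ≤ C ∧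
    ∀ φ, |φ| ≤ β + 1 / 4 → ∀ τ > 0, |angularFamily β m φ τ| ≤ C * Real.exp (τ / 2) := by
  refine ⟨(β + 2) * (1 + 1 / β) * (6 / (1 / 4) ^ 3 * Real.exp (1 / 4)), by positivity,
    fun φ hφ τ hτ => ?_⟩
  have hβτ : 0 < β * τ := by positivity
  have hsinh : β * τ < Real.sinh (β * τ) := Real.self_lt_sinh_iff.2 hβτ
  have hS : 0 < Real.sinh (β * τ) := hβτ.trans hsinh
  have hcosh : Real.cosh (φ * τ) ≤ Real.exp (τ / 4) * Real.cosh (β * τ) := by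
    have h1 : Real.cosh (φ * τ) ≤ Real.cosh (β * τ + τ / 4) := by
      rw [Real.cosh_le_cosh, abs_mul, abs_of_pos hτ,
        abs_of_pos (show 0 < β * τ + τ / 4 by positivity)]
      nlinarith
    have h2 : 0 ≤ Real.sinh (τ / 4) := Real.sinh_nonneg_iff.2 (by positivity)
    rw [Real.cosh_add] at h1
    have h3 := Real.cosh_add_sinh (τ / 4)
    nlinarith [Real.sinh_lt_cosh (β * τ)]
  have hcoth : τ * Real.cosh (β * τ) / Real.sinh (β * τ) ≤ τ + 1 / β := by
    have h1 : Real.cosh (β * τ) ≤ Real.sinh (β * τ) + 1 := by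
      have := Real.cosh_sub_sinh (β * τ)
      have := Real.exp_le_one_iff.2 (neg_nonpos.2 hβτ.le)
      linarith
    have h2 : τ ≤ 1 / β * Real.sinh (β * τ) := by
      rw [div_mul_eq_mul_div, le_div_iff₀ hβ]
      linarith
    rw [div_le_iff₀ hS]
    nlinarith
  have hone : |τ * Real.cosh (φ * τ) / Real.sinh (β * τ)| ≤ Real.exp (τ / 4) * (τ + 1 / β) := by
    have := Real.cosh_pos (φ * τ)
    rw [abs_of_pos (by positivity)]
    calc _ ≤ τ * (Real.exp (τ / 4) * Real.cosh (β * τ)) / Real.sinh (β * τ) := by gcongr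
      _ = Real.exp (τ / 4) * (τ * Real.cosh (β * τ) / Real.sinh (β * τ)) := by ring
      _ ≤ _ := by gcongr
  have hzero : |Real.sinh (φ * τ) / Real.sinh (β * τ)|
      ≤ (β + 1 / 4) * (Real.exp (τ / 4) * (τ + 1 / β)) := by
    refine le_trans ?_ (mul_le_mul hφ hone (abs_nonneg _) (by positivity))
    rw [← abs_mul, ← mul_div_assoc, abs_div, abs_div]
    refine div_le_div_of_nonneg_right ((abs_sinh_le _).trans_eq ?_) (abs_nonneg _)
    rw [← mul_assoc, abs_mul (φ * τ), abs_of_pos (Real.cosh_pos _)]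
  have hpoly : ∀ c, 0 ≤ c → c ≤ (β + 2) * (1 + τ) ^ 2 →
      c * (Real.exp (τ / 4) * (τ + 1 / β))
        ≤ (β + 2) * (1 + 1 / β) * (6 / (1 / 4) ^ 3 * Real.exp (1 / 4)) * Real.exp (τ / 2) := by
    intro c _ hc
    have hexp := pow_le_mul_exp 3 (c := 1 / 4) (by norm_num) (x := 1 + τ) (by linarith)
    have hfac : ((Nat.factorial 3 : ℕ) : ℝ) = 6 := by norm_num [Nat.factorial]
    rw [hfac] at hexp
    have hinv : 0 < 1 / β := by positivity
    have hτβ : τ + 1 / β ≤ (1 + 1 / β) * (1 + τ) := by nlinarith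
    have hE : Real.exp (1 / 4 * (1 + τ)) * Real.exp (τ / 4)
        = Real.exp (1 / 4) * Real.exp (τ / 2) := by
      rw [← Real.exp_add, ← Real.exp_add]; ring_nf
    calc c * (Real.exp (τ / 4) * (τ + 1 / β))
        ≤ (β + 2) * (1 + τ) ^ 2 * (Real.exp (τ / 4) * ((1 + 1 / β) * (1 + τ))) := by gcongr
      _ = (β + 2) * (1 + 1 / β) * ((1 + τ) ^ 3 * Real.exp (τ / 4)) := by ring
      _ ≤ (β + 2) * (1 + 1 / β) * (6 / (1 / 4) ^ 3 * Real.exp (1 / 4 * (1 + τ))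
          * Real.exp (τ / 4)) := by gcongr
      _ = _ := by rw [mul_assoc _ (Real.exp _), hE]; ring
  rcases m with _ | _ | m
  · exact hzero.trans (hpoly _ (by positivity) (by nlinarith))
  · refine hone.trans ?_
    simpa using hpoly 1 zero_le_one (by nlinarith)
  · simp only [angularFamily]
    rw [abs_mul, abs_of_nonneg (sq_nonneg τ)]
    refine (mul_le_mul_of_nonneg_left hzero (sq_nonneg τ)).trans ?_
    rw [← mul_assoc]
    exact hpoly _ (by positivity) (by nlinarith [sq_nonneg τ])

/-- The superposition of `radialFamily j` and `angularFamily m` with density `g`. -/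
noncomputable def wedgeFamily (g : ℝ → ℝ) (β : ℝ) (j m : ℕ) (r φ : ℝ) : ℝ :=
  ∫ τ in Ioi 0, radialFamily j r τ * angularFamily β m φ τ * g τ

lemma wedgeU_eq_wedgeFamily (g : ℝ → ℝ) (β : ℝ) {r : ℝ} (hr : 0 < r) (φ : ℝ) :
    wedgeU g β r φ = wedgeFamily g β 0 0 r φ := by
  refine setIntegral_congr_fun measurableSet_Ioi fun τ hτ => ?_
  simp only [if_neg (ne_of_gt (mem_Ioi.1 hτ)), kernelK_eq hr, radialFamily, angularFamily]

lemma radial_mul_angular_le {β : ℝ} (hβ : 0 < β) (j m : ℕ) {r : ℝ} (hr : 0 < r) :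
    ∃ C : ℝ, 0 ≤ C ∧ ∀ s ∈ Icc (r / 2) (2 * r), ∀ φ, |φ| ≤ β + 1 / 4 → ∀ τ > 0,
      |radialFamily j s τ * angularFamily β m φ τ| ≤ C := by
  obtain ⟨A, hA, hA'⟩ := radialFamily_le j hr
  obtain ⟨B, hB, hB'⟩ := angularFamily_le hβ m
  refine ⟨A * B, by positivity, fun s hs φ hφ τ hτ => ?_⟩
  rw [abs_mul]
  calc _ ≤ A * Real.exp (-(τ / 2)) * (B * Real.exp (τ / 2)) :=
        mul_le_mul (hA' s hs τ hτ) (hB' φ hφ τ hτ) (abs_nonneg _) (by positivity)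
    _ = A * B * (Real.exp (-(τ / 2)) * Real.exp (τ / 2)) := by ring
    _ = A * B := by rw [← Real.exp_add]; simp

lemma integrable_wedgeFamily {g : ℝ → ℝ} (hg : IntegrableOn g (Ioi 0)) {β : ℝ} (hβ : 0 < β)
    (j m : ℕ) {r : ℝ} (hr : 0 < r) {φ : ℝ} (hφ : |φ| ≤ β + 1 / 4) :
    IntegrableOn (fun τ => radialFamily j r τ * angularFamily β m φ τ * g τ) (Ioi 0) := by
  obtain ⟨C, -, hC⟩ := radial_mul_angular_le hβ j m hr
  exact Integrable.bdd_mul hg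
    ((measurable_radialFamily j r).mul (measurable_angularFamily β m φ)).aestronglyMeasurable
    ((ae_restrict_mem measurableSet_Ioi).mono fun τ hτ =>
      hC r ⟨by linarith, by linarith⟩ φ hφ τ hτ)

lemma hasDerivAt_wedgeFamily_radial {g : ℝ → ℝ} (hg : IntegrableOn g (Ioi 0)) {β : ℝ}
    (hβ : 0 < β) {j : ℕ} (hj : j < 4) (m : ℕ) {r : ℝ} (hr : 0 < r) {φ : ℝ}
    (hφ : |φ| ≤ β + 1 / 4) :
    HasDerivAt (fun r => wedgeFamily g β j m r φ) (wedgeFamily g β (j + 1) m r φ / r) r := by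
  obtain ⟨C, hC0, hC⟩ := radial_mul_angular_le hβ j m hr
  obtain ⟨D, hD0, hD⟩ := radial_mul_angular_le hβ (j + 1) m hr
  have h := hasDerivAt_integral_mul_of_bounded hg (s := Ioo (r / 2) (2 * r)) (x := r)
    (C := C + D / (r / 2))
    (F := fun s τ => radialFamily j s τ * angularFamily β m φ τ)
    (F' := fun s τ => radialFamily (j + 1) s τ / s * angularFamily β m φ τ)
    (Ioo_mem_nhds (by linarith) (by linarith))
    (fun s _ => (measurable_radialFamily j s).mul (measurable_angularFamily β m φ))
    (((measurable_radialFamily (j + 1) r).div_const r).mul (measurable_angularFamily β m φ))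
    (fun τ hτ => (hC r ⟨by linarith, by linarith⟩ φ hφ τ hτ).trans
      (le_add_of_nonneg_right (by positivity)))
    (fun s hs τ hτ => ?_)
    (fun s hs τ _ => (hasDerivAt_radialFamily hj (by linarith [hs.1]) τ).mul_const _)
  · refine h.congr_deriv ?_
    rw [wedgeFamily, ← integral_div]
    congr 1 with τ
    ring
  · have hs0 : 0 < s := by linarith [hs.1]
    rw [div_mul_eq_mul_div, abs_div, abs_of_pos hs0]
    refine le_add_of_nonneg_of_le hC0 ?_
    exact div_le_div₀ hD0 (hD s ⟨hs.1.le, hs.2.le⟩ φ hφ τ hτ) (by positivity) hs.1.le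

lemma hasDerivAt_wedgeFamily_angular {g : ℝ → ℝ} (hg : IntegrableOn g (Ioi 0)) {β : ℝ}
    (hβ : 0 < β) (j : ℕ) {m : ℕ} (hm : m < 2) {r : ℝ} (hr : 0 < r) {φ : ℝ}
    (hφ : |φ| < β + 1 / 4) :
    HasDerivAt (fun φ => wedgeFamily g β j m r φ) (wedgeFamily g β j (m + 1) r φ) φ := by
  obtain ⟨C, hC0, hC⟩ := radial_mul_angular_le hβ j m hr
  obtain ⟨D, hD0, hD⟩ := radial_mul_angular_le hβ j (m + 1) hr
  have hr' : r ∈ Icc (r / 2) (2 * r) := ⟨by linarith, by linarith⟩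
  exact hasDerivAt_integral_mul_of_bounded hg (s := Ioo (-(β + 1 / 4)) (β + 1 / 4)) (x := φ)
    (C := C + D)
    (F := fun φ τ => radialFamily j r τ * angularFamily β m φ τ)
    (F' := fun φ τ => radialFamily j r τ * angularFamily β (m + 1) φ τ)
    (Ioo_mem_nhds (abs_lt.1 hφ).1 (abs_lt.1 hφ).2)
    (fun φ _ => (measurable_radialFamily j r).mul (measurable_angularFamily β m φ))
    ((measurable_radialFamily j r).mul (measurable_angularFamily β (m + 1) φ))
    (fun τ hτ => (hC r hr' φ hφ.le τ hτ).trans (le_add_of_nonneg_right hD0))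
    (fun φ hφ τ hτ => (hD r hr' φ (abs_le.2 ⟨hφ.1.le, hφ.2.le⟩) τ hτ).trans
      (le_add_of_nonneg_left hC0))
    (fun φ _ τ _ => (hasDerivAt_angularFamily β hm φ τ).const_mul _)

lemma iteratedDeriv_two_wedgeU {g : ℝ → ℝ} (hg : IntegrableOn g (Ioi 0)) {β : ℝ}
    (hβ : 0 < β) {r : ℝ} (hr : 0 < r) {φ : ℝ} (hφ : |φ| < β + 1 / 4) :
    iteratedDeriv 2 (fun φ => wedgeU g β r φ) φ = wedgeFamily g β 0 2 r φ := by
  simp only [wedgeU_eq_wedgeFamily g β hr]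
  have h1 : deriv (fun φ => wedgeFamily g β 0 0 r φ) =ᶠ[nhds φ]
      fun φ => wedgeFamily g β 0 1 r φ := by
    filter_upwards [(isOpen_lt continuous_abs continuous_const).mem_nhds hφ] with ψ hψ
    exact (hasDerivAt_wedgeFamily_angular hg hβ 0 (by norm_num) hr hψ).deriv
  rw [iteratedDeriv_succ, iteratedDeriv_one, h1.deriv_eq]
  exact (hasDerivAt_wedgeFamily_angular hg hβ 0 (by norm_num) hr hφ).deriv

/-- Iterated derivatives in terms of the Euler operator `r d/dr`. -/
lemma iteratedDeriv_of_euler {V : ℕ → ℝ → ℝ}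
    (hV : ∀ j < 4, ∀ r > 0, HasDerivAt (V j) (V (j + 1) r / r) r) {r : ℝ} (hr : 0 < r) :
    deriv (V 0) r = V 1 r / r ∧
    iteratedDeriv 2 (V 0) r = (V 2 r - V 1 r) / r ^ 2 ∧
    iteratedDeriv 3 (V 0) r = (V 3 r - 3 * V 2 r + 2 * V 1 r) / r ^ 3 ∧
    iteratedDeriv 4 (V 0) r = (V 4 r - 6 * V 3 r + 11 * V 2 r - 6 * V 1 r) / r ^ 4 := by
  have hstep : ∀ {n : ℕ} {F F' : ℝ → ℝ}, (∀ r > 0, iteratedDeriv n (V 0) r = F r) →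
      (∀ r > 0, HasDerivAt F (F' r) r) → ∀ r > 0, iteratedDeriv (n + 1) (V 0) r = F' r := by
    intro n F F' hF hF' r hr
    have : iteratedDeriv n (V 0) =ᶠ[nhds r] F :=
      eventually_of_mem (Ioi_mem_nhds hr) fun s hs => hF s hs
    rw [iteratedDeriv_succ, this.deriv_eq, (hF' r hr).deriv]
  have h1 := hstep (n := 0) (F := V 0) (fun r _ => by simp) (hV 0 (by norm_num))
  have h2 := hstep h1 (F' := fun r => (V 2 r - V 1 r) / r ^ 2) fun r hr => by
    refine ((hV 1 (by norm_num) r hr).div (hasDerivAt_id r) hr.ne').congr_deriv ?_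
    simp only [id]
    field_simp
  have h3 := hstep h2 (F' := fun r => (V 3 r - 3 * V 2 r + 2 * V 1 r) / r ^ 3) fun r hr => by
    refine (((hV 2 (by norm_num) r hr).sub (hV 1 (by norm_num) r hr)).div
      (hasDerivAt_pow 2 r) (pow_ne_zero 2 hr.ne')).congr_deriv ?_
    simp only [Pi.sub_apply]
    field_simp
    push_cast
    ring
  have h4 := hstep h3
    (F' := fun r => (V 4 r - 6 * V 3 r + 11 * V 2 r - 6 * V 1 r) / r ^ 4) fun r hr => by
    refine ((((hV 3 (by norm_num) r hr).sub ((hV 2 (by norm_num) r hr).const_mul 3)).add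
      ((hV 1 (by norm_num) r hr).const_mul 2)).div
      (hasDerivAt_pow 3 r) (pow_ne_zero 3 hr.ne')).congr_deriv ?_
    simp only [Pi.sub_apply, Pi.add_apply]
    field_simp
    push_cast
    ring
  exact ⟨by simpa using h1 r hr, h2 r hr, h3 r hr, h4 r hr⟩

lemma wedgeFamily_pde {g : ℝ → ℝ} (hg : IntegrableOn g (Ioi 0)) {β : ℝ} (hβ : 0 < β) {r : ℝ}
    (hr : 0 < r) {φ : ℝ} (hφ : |φ| ≤ β + 1 / 4) :
    wedgeFamily g β 4 0 r φ - 1 / 2 * wedgeFamily g β 3 0 r φ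
      + (wedgeFamily g β 2 2 r φ - 1 / 2 * wedgeFamily g β 1 2 r φ)
      = r * wedgeFamily g β 0 0 r φ := by
  have hi := fun j m => integrable_wedgeFamily hg hβ j m hr hφ
  have h3 := (hi 3 0).const_mul (1 / 2)
  have h1 := (hi 1 2).const_mul (1 / 2)
  simp only [wedgeFamily]
  rw [← integral_const_mul, ← integral_const_mul, ← integral_const_mul, ← integral_sub (hi 4 0) h3,
    ← integral_sub (hi 2 2) h1, ← integral_add (by exact (hi 4 0).sub h3) (by exact (hi 2 2).sub h1)]
  congr 1 with τ
  have hode := radialFamily_ode r τ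
  simp only [angularFamily]
  linear_combination (Real.sinh (φ * τ) / Real.sinh (β * τ) * g τ) * hode

lemma radialFamily_zero_le {r : ℝ} (hr : 1 ≤ radialArg r) (τ : ℝ) :
    radialFamily 0 r τ ≤ Real.exp (-((radialArg r - 1) / 2)) * Real.exp (-τ)
      * (∫ t, Real.exp (-(1 / 4) * Real.cosh t)) ^ 2 := by
  set w := radialArg r
  set N := ∫ t, Real.exp (-(1 / 4) * Real.cosh t)
  have hint : ∫ t, Real.exp (-(w / 4) * Real.cosh t) ≤ Real.exp (-((w - 1) / 4)) * N := by
    rw [← integral_const_mul]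
    have hi : ∀ {c : ℝ}, 0 < c → Integrable fun t => Real.exp (-c * Real.cosh t) := fun hc => by
      simpa only [pow_zero, one_mul] using integrable_cosh_pow_mul_exp 0 hc
    refine integral_mono (hi (by positivity)) ((hi (by norm_num)).const_mul _) fun t => ?_
    dsimp only
    rw [← Real.exp_add]
    refine Real.exp_le_exp.2 ?_
    nlinarith [Real.one_le_cosh t]
  have hnorm : ‖radialVal r τ‖ ≤ Real.exp (-(τ / 2)) * (Real.exp (-((w - 1) / 4)) * N) := by
    have h := norm_rotMoment_le (by positivity) le_rfl 0 (w := w) τ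
    simp only [pow_zero, one_mul] at h
    rw [radialVal, norm_mul, show ‖(1 / 2 : ℂ)‖ = 1 / 2 by norm_num]
    have := h.trans (mul_le_mul_of_nonneg_left hint (Real.exp_pos _).le)
    linarith [norm_nonneg (rotMoment 0 w τ)]
  calc radialFamily 0 r τ = ‖radialVal r τ‖ ^ 2 := by
        rw [Complex.sq_norm, Complex.normSq_apply, radialFamily]; ring
    _ ≤ (Real.exp (-(τ / 2)) * (Real.exp (-((w - 1) / 4)) * N)) ^ 2 := by gcongr
    _ = _ := by
        rw [mul_pow, mul_pow, ← Real.exp_nat_mul, ← Real.exp_nat_mul]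
        push_cast
        ring_nf

lemma tendsto_radialArg_atTop : Tendsto radialArg atTop atTop :=
  ((tendsto_rpow_atTop (by norm_num)).comp
    (tendsto_id.const_mul_atTop (by norm_num : (0 : ℝ) < 4))).const_mul_atTop two_pos

lemma tendsto_wedgeFamily {g : ℝ → ℝ} (hg : IntegrableOn g (Ioi 0)) {β : ℝ} (hβ : 0 < β) {φ : ℝ}
    (hφ : |φ| ≤ β + 1 / 4) :
    Tendsto (fun r => wedgeFamily g β 0 0 r φ) atTop (nhds 0) := by
  obtain ⟨B, hB, hB'⟩ := angularFamily_le hβ 0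
  set N : ℝ := ∫ t, Real.exp (-(1 / 4) * Real.cosh t)
  have hlim : Tendsto (fun r => Real.exp (-((radialArg r - 1) / 2))
      * (N ^ 2 * B * ∫ τ in Ioi 0, |g τ|)) atTop (nhds 0) := by
    suffices h : Tendsto (fun r => (radialArg r - 1) / 2) atTop atTop by
      simpa using (Real.tendsto_exp_neg_atTop_nhds_zero.comp h).mul_const
        (N ^ 2 * B * ∫ τ in Ioi 0, |g τ|)
    exact (tendsto_atTop_add_const_right _ (-1) tendsto_radialArg_atTop).atTop_div_const two_pos
  refine squeeze_zero_norm' ?_ hlim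
  filter_upwards [tendsto_radialArg_atTop.eventually_ge_atTop 1] with r hr
  rw [← integral_const_mul, ← integral_const_mul]
  refine norm_integral_le_of_norm_le ((hg.abs.const_mul _).const_mul _)
    ((ae_restrict_mem measurableSet_Ioi).mono fun τ hτ => ?_)
  have hτ : 0 < τ := hτ
  have hpos : 0 ≤ radialFamily 0 r τ := by rw [radialFamily]; positivity
  rw [norm_mul, norm_mul, Real.norm_of_nonneg hpos, Real.norm_eq_abs, Real.norm_eq_abs]
  have hE : Real.exp (-τ) * Real.exp (τ / 2) ≤ 1 := by
    rw [← Real.exp_add]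
    exact Real.exp_le_one_iff.2 (by linarith)
  calc _ ≤ Real.exp (-((radialArg r - 1) / 2)) * Real.exp (-τ) * N ^ 2
        * (B * Real.exp (τ / 2)) * |g τ| := by
        gcongr
        · exact radialFamily_zero_le hr τ
        · exact hB' φ hφ τ hτ
    _ = Real.exp (-((radialArg r - 1) / 2)) * (N ^ 2 * B * |g τ|)
        * (Real.exp (-τ) * Real.exp (τ / 2)) := by ring
    _ ≤ Real.exp (-((radialArg r - 1) / 2)) * (N ^ 2 * B * |g τ|) * 1 := by gcongr
    _ = _ := mul_one _

/-- Lemma 3: u(r,θ) satisfies the fourth-order PDE (4.2) on the wedge and vanishes at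
infinity. -/
theorem wedgeU_solves_pde (g : ℝ → ℝ) (hgm : Measurable g)
    (hg : MeasureTheory.IntegrableOn (fun τ => |g τ| * (τ^2 + 1)) (Set.Ioi 0))
    (β : ℝ) (hβ1 : 0 < β) (hβ2 : β < 2*Real.pi) :
    (∀ r : ℝ, 0 < r → ∀ θ ∈ Set.Icc (0:ℝ) β,
      r^3 * iteratedDeriv 4 (fun s => wedgeU g β s θ) r
        + r * iteratedDeriv 2 (fun s => iteratedDeriv 2 (fun φ => wedgeU g β s φ) θ) r
        + (11/2) * r^2 * iteratedDeriv 3 (fun s => wedgeU g β s θ) r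
        + (1/2) * deriv (fun s => iteratedDeriv 2 (fun φ => wedgeU g β s φ) θ) r
        + (11/2) * r * iteratedDeriv 2 (fun s => wedgeU g β s θ) r
        + (1/2) * deriv (fun s => wedgeU g β s θ) r
        - wedgeU g β r θ = 0) ∧
    (∀ θ ∈ Set.Icc (0:ℝ) β, Tendsto (fun r => wedgeU g β r θ) atTop (nhds 0)) := by
  have hgi : IntegrableOn g (Ioi 0) := hg.mono' hgm.aestronglyMeasurable
    (ae_of_all _ fun τ => by
      rw [Real.norm_eq_abs]
      nlinarith [abs_nonneg (g τ), sq_nonneg τ, mul_nonneg (abs_nonneg (g τ)) (sq_nonneg τ)])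
  have habs : ∀ θ ∈ Icc 0 β, |θ| < β + 1 / 4 := fun θ hθ => by
    rw [abs_of_nonneg hθ.1]
    linarith [hθ.2]
  refine ⟨fun r hr θ hθ => ?_, fun θ hθ => ?_⟩
  · have hθ' := habs θ hθ
    have hU : (fun s => wedgeU g β s θ) =ᶠ[nhds r] fun s => wedgeFamily g β 0 0 s θ :=
      eventually_of_mem (Ioi_mem_nhds hr) fun s hs => wedgeU_eq_wedgeFamily g β hs θ
    have hUθθ : (fun s => iteratedDeriv 2 (fun φ => wedgeU g β s φ) θ)
        =ᶠ[nhds r] fun s => wedgeFamily g β 0 2 s θ :=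
      eventually_of_mem (Ioi_mem_nhds hr) fun s hs => iteratedDeriv_two_wedgeU hgi hβ1 hs hθ'
    obtain ⟨u1, u2, u3, u4⟩ := iteratedDeriv_of_euler
      (V := fun j s => wedgeFamily g β j 0 s θ)
      (fun j hj s hs => hasDerivAt_wedgeFamily_radial hgi hβ1 hj 0 hs hθ'.le) hr
    obtain ⟨w1, w2, -, -⟩ := iteratedDeriv_of_euler
      (V := fun j s => wedgeFamily g β j 2 s θ)
      (fun j hj s hs => hasDerivAt_wedgeFamily_radial hgi hβ1 hj 2 hs hθ'.le) hr
    have hpde := wedgeFamily_pde hgi hβ1 hr hθ'.le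
    rw [hU.iteratedDeriv_eq 4, hU.iteratedDeriv_eq 3, hU.iteratedDeriv_eq 2, hU.deriv_eq,
      hUθθ.iteratedDeriv_eq 2, hUθθ.deriv_eq, u1, u2, u3, u4, w1, w2,
      wedgeU_eq_wedgeFamily g β hr θ]
    field_simp
    linear_combination 2 * hpde
  · refine (tendsto_wedgeFamily hgi hβ1 (habs θ hθ).le).congr' ?_
    filter_upwards [eventually_gt_atTop 0] with r hr
    exact (wedgeU_eq_wedgeFamily g β hr θ).symm
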